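/- (Theorem 1, Variant 2: recursive feasibility, constraint satisfaction and convergence of rollout ETC with periodic terminal ingredients.) Consider the networked control system with token bucket traffic specification, M ≥ 2, and rollout ETC in Variant 2: terminal sets Ξ_f(k) = S_{k mod M} where S₀ = Z₀ × (ℤ ∩ [c−g, b]), S_j = Z_j × (ℤ ∩ [(j−1)g, b]) for j = 1, …, M−1, and the closed sets Z_j ⊆ 𝕏 × 𝕌 containing the origin satisfy A₁Z₀ ⊆ Z₁, A₀Z_j ⊆ Z_{j+1} for j = 1, …, M−2, A₀Z_{M−1} ⊆ Z₀ and K Z₀ ⊆ 𝕌; terminal costs V_f(ξ, k) = [x; u]ᵀ P_{k mod M} [x; u] with symmetric positive semidefinite P₀, …, P_{M−1} satisfying A₁ᵀP₁A₁ − P₀ + diag(Q, 0) + KᵀRK ⪯ 0 and A₀ᵀP_{(j+1) mod M}A₀ − P_j + diag(Q, R) ⪯ 0 for j = 1, …, M−1; and constant prediction horizon N(k) = N̄ ∈ ℕ, N̄ ≥ 1. If the optimal control problem P(ξ(0), 0) is feasible, then along every closed-loop trajectory ξ(k+1) = f(ξ(k), π(k)) in which each π(k) is the first element of a minimizer of P(ξ(k),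 k): (i) P(ξ(k), k) is feasible for every k ∈ ℕ; (ii) ξ(k) ∈ Ξ and π(k) ∈ Π for every k; and (iii) (x(k), u(k)) → (0, 0) as k → ∞. -/

import Mathlib

open Matrix

/-- Overall state of the networked control system: plant state `x`,
held input `u`, and integer bucket level `β`. -/
abbrev NCSState (n m : ℕ) := (Fin n → ℝ) × (Fin m → ℝ) × ℤ

/-- Overall input: control update `v` and transmission decision `γ ∈ {0,1}`
(modelled as a `Bool`). -/
abbrev NCSInput (n m : ℕ) := (Fin m → ℝ) × Bool

/-- Overall dynamics
`f(ξ, π) = (Ax + Bγv + B(1-γ)u, γv + (1-γ)u, min (β + g - γc) b)`. -/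
noncomputable def ncsDyn {n m : ℕ} (A : Matrix (Fin n) (Fin n) ℝ)
    (B : Matrix (Fin n) (Fin m) ℝ) (g c b : ℕ)
    (ξ : NCSState n m) (π : NCSInput n m) : NCSState n m :=
  ⟨A.mulVec ξ.1 + B.mulVec (if π.2 then π.1 else ξ.2.1),
   if π.2 then π.1 else ξ.2.1,
   min (ξ.2.2 + (g : ℤ) - if π.2 then (c : ℤ) else 0) (b : ℤ)⟩

/-- The stacked vector `z = [x; u] ∈ ℝ^{n+m}`. -/
def vcat {n m : ℕ} (x : Fin n → ℝ) (u : Fin m → ℝ) : Fin n ⊕ Fin m → ℝ :=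
  Sum.elim x u

/-- No-transmission step matrix `A₀ = [[A, B], [0, I]]`. -/
noncomputable def A0mat {n m : ℕ} (A : Matrix (Fin n) (Fin n) ℝ)
    (B : Matrix (Fin n) (Fin m) ℝ) :
    Matrix (Fin n ⊕ Fin m) (Fin n ⊕ Fin m) ℝ :=
  fromBlocks A B 0 1

/-- Transmission step matrix `A₁ = [[A, 0], [0, 0]] + [[B], [I]] K`. -/
noncomputable def A1mat {n m : ℕ} (A : Matrix (Fin n) (Fin n) ℝ)
    (B : Matrix (Fin n) (Fin m) ℝ) (K : Matrix (Fin m) (Fin n ⊕ Fin m) ℝ) :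
    Matrix (Fin n ⊕ Fin m) (Fin n ⊕ Fin m) ℝ :=
  fromBlocks A 0 0 0 + fromRows B (1 : Matrix (Fin m) (Fin m) ℝ) * K

/-- The trajectory of the overall system generated from initial state `ξ0`
by the input sequence `πs`. -/
noncomputable def ncsTraj {n m : ℕ} (A : Matrix (Fin n) (Fin n) ℝ)
    (B : Matrix (Fin n) (Fin m) ℝ) (g c b : ℕ)
    (ξ0 : NCSState n m) (πs : ℕ → NCSInput n m) : ℕ → NCSState n m
  | 0 => ξ0
  | k + 1 => ncsDyn A B g c b (ncsTraj A B g c b ξ0 πs k) (πs k)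

/-- Stage cost `ℓ(ξ, π) = xᵀQx + (1-γ)uᵀRu + γvᵀRv`. -/
noncomputable def stageCost {n m : ℕ} (Q : Matrix (Fin n) (Fin n) ℝ)
    (R : Matrix (Fin m) (Fin m) ℝ) (ξ : NCSState n m) (π : NCSInput n m) : ℝ :=
  ξ.1 ⬝ᵥ Q.mulVec ξ.1 +
    (if π.2 then π.1 ⬝ᵥ R.mulVec π.1 else ξ.2.1 ⬝ᵥ R.mulVec ξ.2.1)

/-- Feasibility for the constrained OCP: state constraints
`ξ(i) ∈ Ξ = 𝕏 × 𝕌 × (ℤ ∩ [0, b])` and input constraints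
`π(i) ∈ Π = 𝕌 × {0,1}` for `i = 0, …, N-1`, and terminal constraint
`ξ(N) ∈ Ξf`. -/
noncomputable def FeasOCP {n m : ℕ} (A : Matrix (Fin n) (Fin n) ℝ)
    (B : Matrix (Fin n) (Fin m) ℝ) (g c b : ℕ)
    (𝕏 : Set (Fin n → ℝ)) (𝕌 : Set (Fin m → ℝ))
    (ξ0 : NCSState n m) (N : ℕ) (Ξf : Set (NCSState n m))
    (πs : ℕ → NCSInput n m) : Prop :=
  (∀ i < N, (ncsTraj A B g c b ξ0 πs i).1 ∈ 𝕏 ∧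
      (ncsTraj A B g c b ξ0 πs i).2.1 ∈ 𝕌 ∧
      0 ≤ (ncsTraj A B g c b ξ0 πs i).2.2 ∧
      (ncsTraj A B g c b ξ0 πs i).2.2 ≤ (b : ℤ) ∧
      (πs i).1 ∈ 𝕌) ∧
  ncsTraj A B g c b ξ0 πs N ∈ Ξf

/-- Cost of the OCP with horizon `N` and terminal cost `Vf`:
`Σ_{i<N} ℓ(ξ(i), π(i)) + Vf(ξ(N))`. -/
noncomputable def costGen {n m : ℕ} (A : Matrix (Fin n) (Fin n) ℝ)
    (B : Matrix (Fin n) (Fin m) ℝ) (g c b : ℕ)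
    (Q : Matrix (Fin n) (Fin n) ℝ) (R : Matrix (Fin m) (Fin m) ℝ)
    (Vf : NCSState n m → ℝ)
    (ξ0 : NCSState n m) (N : ℕ) (πs : ℕ → NCSInput n m) : ℝ :=
  ∑ i ∈ Finset.range N, stageCost Q R (ncsTraj A B g c b ξ0 πs i) (πs i) +
    Vf (ncsTraj A B g c b ξ0 πs N)

/-- The Variant-2 terminal sets: `S₀ = Z₀ × (ℤ ∩ [c-g, b])` and
`S_j = Z_j × (ℤ ∩ [(j-1)g, b])` for `j = 1, …, M-1`. -/
def termSet {n m : ℕ} (g c b : ℕ) (Z : ℕ → Set (Fin n ⊕ Fin m → ℝ)) (j : ℕ) :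
    Set (NCSState n m) :=
  if j = 0 then
    {ξ : NCSState n m | vcat ξ.1 ξ.2.1 ∈ Z 0 ∧
      (c : ℤ) - (g : ℤ) ≤ ξ.2.2 ∧ ξ.2.2 ≤ (b : ℤ)}
  else
    {ξ : NCSState n m | vcat ξ.1 ξ.2.1 ∈ Z j ∧
      ((j : ℤ) - 1) * (g : ℤ) ≤ ξ.2.2 ∧ ξ.2.2 ≤ (b : ℤ)}

/-- Coercivity of a positive definite quadratic form. -/
lemma posDef_coercive {p : ℕ} {Q : Matrix (Fin p) (Fin p) ℝ} (hQ : Q.PosDef) :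
    ∃ e : ℝ, 0 < e ∧ ∀ x : Fin p → ℝ, e * ‖x‖ ^ 2 ≤ x ⬝ᵥ Q.mulVec x := by
  have hpos : ∀ x : Fin p → ℝ, x ≠ 0 → 0 < x ⬝ᵥ Q.mulVec x := fun x hx => by
    simpa using hQ.dotProduct_mulVec_pos hx
  have hcont : Continuous (fun x : Fin p → ℝ => x ⬝ᵥ Q.mulVec x) := by
    fun_prop
  rcases (Metric.sphere (0 : Fin p → ℝ) 1).eq_empty_or_nonempty with he | hne
  · refine ⟨1, one_pos, fun x => ?_⟩
    by_cases hx : x = 0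
    · simp [hx]
    · exfalso
      have hn : ‖x‖ ≠ 0 := norm_ne_zero_iff.mpr hx
      have : ‖x‖⁻¹ • x ∈ Metric.sphere (0 : Fin p → ℝ) 1 := by
        simp [norm_smul, hn]
      rw [he] at this
      exact this
  · obtain ⟨y, hy, hmin⟩ :=
      (isCompact_sphere (0 : Fin p → ℝ) 1).exists_isMinOn hne hcont.continuousOn
    have hy0 : y ≠ 0 := by
      rintro rfl
      simp at hy
    refine ⟨y ⬝ᵥ Q.mulVec y, hpos y hy0, fun x => ?_⟩
    by_cases hx : x = 0
    · simp [hx]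
    · have hn : ‖x‖ ≠ 0 := norm_ne_zero_iff.mpr hx
      have hs : ‖x‖⁻¹ • x ∈ Metric.sphere (0 : Fin p → ℝ) 1 := by
        simp [norm_smul, hn]
      have h1 : y ⬝ᵥ Q.mulVec y ≤ (‖x‖⁻¹ • x) ⬝ᵥ Q.mulVec (‖x‖⁻¹ • x) := hmin hs
      have h2 : (‖x‖⁻¹ • x) ⬝ᵥ Q.mulVec (‖x‖⁻¹ • x) * ‖x‖ ^ 2 = x ⬝ᵥ Q.mulVec x := by
        simp only [mulVec_smul, smul_dotProduct, dotProduct_smul, smul_eq_mul]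
        field_simp
      rw [← h2]
      exact mul_le_mul_of_nonneg_right h1 (by positivity)

lemma tendsto_zero_of_quad {p : ℕ} {Q : Matrix (Fin p) (Fin p) ℝ} (hQ : Q.PosDef)
    (x : ℕ → Fin p → ℝ)
    (h : Filter.Tendsto (fun k => x k ⬝ᵥ Q.mulVec (x k)) Filter.atTop (nhds 0)) :
    Filter.Tendsto x Filter.atTop (nhds 0) := by
  obtain ⟨e, he, hc⟩ := posDef_coercive hQ
  have h1 : Filter.Tendsto (fun k => ‖x k‖ ^ 2) Filter.atTop (nhds 0) := by
    have h2 : Filter.Tendsto (fun k => e⁻¹ * (x k ⬝ᵥ Q.mulVec (x k)))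
        Filter.atTop (nhds 0) := by
      simpa using h.const_mul e⁻¹
    refine squeeze_zero (fun k => by positivity) (fun k => ?_) h2
    have := hc (x k)
    rw [inv_mul_eq_div, le_div_iff₀ he]
    linarith
  rw [tendsto_zero_iff_norm_tendsto_zero]
  have h3 := h1.sqrt
  simpa using h3

lemma ncsTraj_shift {n m : ℕ} (A : Matrix (Fin n) (Fin n) ℝ)
    (B : Matrix (Fin n) (Fin m) ℝ) (g c b : ℕ)
    (ξ0 : NCSState n m) (πs : ℕ → NCSInput n m) (i : ℕ) :
    ncsTraj A B g c b (ncsDyn A B g c b ξ0 (πs 0)) (fun i => πs (i + 1)) i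
      = ncsTraj A B g c b ξ0 πs (i + 1) := by
  induction i with
  | zero => rfl
  | succ i ih =>
    rw [ncsTraj, ih]
    rfl

lemma ncsTraj_congr {n m : ℕ} (A : Matrix (Fin n) (Fin n) ℝ)
    (B : Matrix (Fin n) (Fin m) ℝ) (g c b : ℕ)
    (ξ0 : NCSState n m) (πs πs' : ℕ → NCSInput n m) (N : ℕ)
    (h : ∀ i < N, πs i = πs' i) :
    ∀ i ≤ N, ncsTraj A B g c b ξ0 πs i = ncsTraj A B g c b ξ0 πs' i := by
  intro i
  induction i with
  | zero => intro _; rfl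
  | succ i ih =>
    intro hi
    rw [ncsTraj, ncsTraj, ih (by omega), h i (by omega)]

lemma A0mat_mulVec {n m : ℕ} (A : Matrix (Fin n) (Fin n) ℝ)
    (B : Matrix (Fin n) (Fin m) ℝ) (x : Fin n → ℝ) (u : Fin m → ℝ) :
    (A0mat A B).mulVec (vcat x u) = vcat (A.mulVec x + B.mulVec u) u := by
  simp [A0mat, vcat, fromBlocks_mulVec]

lemma A1mat_mulVec {n m : ℕ} (A : Matrix (Fin n) (Fin n) ℝ)
    (B : Matrix (Fin n) (Fin m) ℝ) (K : Matrix (Fin m) (Fin n ⊕ Fin m) ℝ)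
    (x : Fin n → ℝ) (u : Fin m → ℝ) :
    (A1mat A B K).mulVec (vcat x u)
      = vcat (A.mulVec x + B.mulVec (K.mulVec (vcat x u))) (K.mulVec (vcat x u)) := by
  rw [A1mat, add_mulVec, ← mulVec_mulVec, fromRows_mulVec]
  ext i
  rcases i with i | i <;> simp [vcat, fromBlocks_mulVec]

/-- Quadratic forms transform by congruence. -/
lemma quad_congr {p q : Type*} [Fintype p] [Fintype q] (T : Matrix p q ℝ)
    (S : Matrix p p ℝ) (z : q → ℝ) :
    z ⬝ᵥ (Tᵀ * S * T).mulVec z = T.mulVec z ⬝ᵥ S.mulVec (T.mulVec z) := by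
  rw [← mulVec_mulVec, ← mulVec_mulVec, dotProduct_mulVec, vecMul_transpose]

lemma quad_blocks {n m : ℕ} (Q : Matrix (Fin n) (Fin n) ℝ)
    (R : Matrix (Fin m) (Fin m) ℝ) (x : Fin n → ℝ) (u : Fin m → ℝ) :
    vcat x u ⬝ᵥ (fromBlocks Q 0 0 R).mulVec (vcat x u)
      = x ⬝ᵥ Q.mulVec x + u ⬝ᵥ R.mulVec u := by
  simp [vcat, fromBlocks_mulVec, dotProduct, Fintype.sum_sum_type]

lemma period_bound (g c M : ℕ) (hg : 1 ≤ g) (hM : M = ⌈(c : ℚ) / (g : ℚ)⌉₊) :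
    c ≤ M * g ∧ (1 ≤ M → (M - 1) * g ≤ c) := by
  have hg' : (0 : ℚ) < g := by exact_mod_cast hg
  constructor
  · have h : (c : ℚ) / g ≤ M := by rw [hM]; exact Nat.le_ceil _
    rw [div_le_iff₀ hg'] at h
    exact_mod_cast h
  · intro h1
    have h : M - 1 < ⌈(c : ℚ) / (g : ℚ)⌉₊ := by omega
    rw [Nat.lt_ceil, lt_div_iff₀ hg'] at h
    exact_mod_cast h.le

/-- The terminal ingredients: invariance and cost decrease. -/
lemma terminal_step {n m : ℕ}
    (A : Matrix (Fin n) (Fin n) ℝ) (B : Matrix (Fin n) (Fin m) ℝ)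
    (K : Matrix (Fin m) (Fin n ⊕ Fin m) ℝ)
    (g c b M : ℕ) (hg : 1 ≤ g) (hgc : g ≤ c) (hcb : c ≤ b)
    (hM : M = ⌈(c : ℚ) / (g : ℚ)⌉₊) (hM2 : 2 ≤ M)
    (𝕏 : Set (Fin n → ℝ)) (𝕌 : Set (Fin m → ℝ))
    (hU0 : (0 : Fin m → ℝ) ∈ 𝕌)
    (Z : ℕ → Set (Fin n ⊕ Fin m → ℝ))
    (hZsub : ∀ j : ℕ, j + 1 ≤ M → ∀ z ∈ Z j,
      (fun i => z (Sum.inl i)) ∈ 𝕏 ∧ (fun i => z (Sum.inr i)) ∈ 𝕌)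
    (hinv1 : ∀ z ∈ Z 0, (A1mat A B K).mulVec z ∈ Z 1)
    (hinv2 : ∀ j : ℕ, 1 ≤ j → j + 2 ≤ M → ∀ z ∈ Z j,
      (A0mat A B).mulVec z ∈ Z (j + 1))
    (hinv3 : ∀ z ∈ Z (M - 1), (A0mat A B).mulVec z ∈ Z 0)
    (hK : ∀ z ∈ Z 0, K.mulVec z ∈ 𝕌)
    (Q : Matrix (Fin n) (Fin n) ℝ) (R : Matrix (Fin m) (Fin m) ℝ)
    (P : ℕ → Matrix (Fin n ⊕ Fin m) (Fin n ⊕ Fin m) ℝ)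
    (hMI0 : (-((A1mat A B K)ᵀ * P 1 * A1mat A B K - P 0
        + fromBlocks Q 0 0 0 + Kᵀ * R * K)).PosSemidef)
    (hMIj : ∀ j : ℕ, 1 ≤ j → j + 1 ≤ M →
      (-((A0mat A B)ᵀ * P ((j + 1) % M) * A0mat A B - P j
          + fromBlocks Q 0 0 R)).PosSemidef)
    (j : ℕ) (hj : j < M) (ξ : NCSState n m) (hξ : ξ ∈ termSet g c b Z j) :
    ξ.1 ∈ 𝕏 ∧ ξ.2.1 ∈ 𝕌 ∧ 0 ≤ ξ.2.2 ∧ ξ.2.2 ≤ (b : ℤ) ∧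
    ∃ π : NCSInput n m, π.1 ∈ 𝕌 ∧
      ncsDyn A B g c b ξ π ∈ termSet g c b Z ((j + 1) % M) ∧
      stageCost Q R ξ π +
        vcat (ncsDyn A B g c b ξ π).1 (ncsDyn A B g c b ξ π).2.1 ⬝ᵥ
          (P ((j + 1) % M)).mulVec
            (vcat (ncsDyn A B g c b ξ π).1 (ncsDyn A B g c b ξ π).2.1)
        ≤ vcat ξ.1 ξ.2.1 ⬝ᵥ (P j).mulVec (vcat ξ.1 ξ.2.1) := by
  obtain ⟨x, u, β⟩ := ξ
  obtain ⟨hb1, hb2⟩ := period_bound g c M hg hM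
  have hb2 := hb2 (by omega)
  obtain ⟨M', rfl⟩ : ∃ M', M = M' + 1 := ⟨M - 1, by omega⟩
  simp only [Nat.add_sub_cancel] at hb2 hinv3
  zify at hb1 hb2 hg hgc hcb
  have hz : vcat x u ∈ Z j := by
    unfold termSet at hξ
    split_ifs at hξ with h
    · subst h; exact hξ.1
    · exact hξ.1
  have hxu := hZsub j (by omega) _ hz
  refine ⟨hxu.1, hxu.2, ?_⟩
  by_cases h0 : j = 0
  · subst h0
    simp only [termSet, if_true, Set.mem_setOf_eq] at hξ
    obtain ⟨-, hβ1, hβ2⟩ := hξ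
    refine ⟨by simp only; omega, hβ2, (K.mulVec (vcat x u), true), hK _ hz, ?_, ?_⟩
    · have : (0 + 1) % (M' + 1) = 1 := Nat.mod_eq_of_lt (by omega)
      rw [this]
      simp only [termSet, ncsDyn, if_true, one_ne_zero, if_false, Set.mem_setOf_eq]
      refine ⟨?_, ?_, min_le_right _ _⟩
      · rw [← A1mat_mulVec]; exact hinv1 _ hz
      · push_cast
        rw [le_min_iff]
        constructor <;> omega
    · have : (0 + 1) % (M' + 1) = 1 := Nat.mod_eq_of_lt (by omega)
      rw [this]
      have h := hMI0.dotProduct_mulVec_nonneg (vcat x u)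
      simp only [star_trivial, neg_mulVec, add_mulVec, sub_mulVec, dotProduct_neg,
        dotProduct_add, dotProduct_sub, quad_congr, quad_blocks, A1mat_mulVec] at h
      simp only [stageCost, ncsDyn, if_true]
      simp only [zero_mulVec, dotProduct_zero] at h
      linarith
  · simp only [termSet, h0, if_false, Set.mem_setOf_eq] at hξ
    obtain ⟨-, hβ1, hβ2⟩ := hξ
    have hj1 : (0 : ℤ) ≤ (j : ℤ) - 1 := by omega
    have hjg : (0 : ℤ) ≤ ((j : ℤ) - 1) * g := mul_nonneg hj1 (by omega)
    refine ⟨by simp only; omega, hβ2, (0, false), hU0, ?_, ?_⟩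
    · rcases Nat.lt_or_ge (j + 1) (M' + 1) with h1 | h1
      · rw [Nat.mod_eq_of_lt h1]
        simp only [termSet, ncsDyn, Bool.false_eq_true, Nat.succ_ne_zero, if_false,
          Set.mem_setOf_eq]
        refine ⟨?_, ?_, min_le_right _ _⟩
        · rw [← A0mat_mulVec]; exact hinv2 j (by omega) (by omega) _ hz
        · push_cast
          have : (j : ℤ) * g ≤ M' * g :=
            mul_le_mul_of_nonneg_right (by omega) (by omega)
          rw [le_min_iff]
          constructor <;> linarith
      · obtain rfl : j = M' := by omega
        rw [Nat.mod_self]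
        simp only [termSet, ncsDyn, Bool.false_eq_true, if_true, if_false,
          Set.mem_setOf_eq]
        refine ⟨?_, ?_, min_le_right _ _⟩
        · rw [← A0mat_mulVec]; exact hinv3 _ hz
        · rw [le_min_iff]
          constructor <;> linarith
    · have h := (hMIj j (by omega) (by omega)).dotProduct_mulVec_nonneg (vcat x u)
      simp only [star_trivial, neg_mulVec, add_mulVec, sub_mulVec, dotProduct_neg,
        dotProduct_add, dotProduct_sub, quad_congr, quad_blocks, A0mat_mulVec] at h
      simp only [stageCost, ncsDyn, Bool.false_eq_true, if_false]
      linarith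

/-- Shifted candidate: feasibility at the next step and cost decrease. -/
lemma candidate_step {n m : ℕ}
    (A : Matrix (Fin n) (Fin n) ℝ) (B : Matrix (Fin n) (Fin m) ℝ) (g c b : ℕ)
    (𝕏 : Set (Fin n → ℝ)) (𝕌 : Set (Fin m → ℝ))
    (Q : Matrix (Fin n) (Fin n) ℝ) (R : Matrix (Fin m) (Fin m) ℝ)
    (N : ℕ) (hN : 1 ≤ N) (S S' : Set (NCSState n m)) (V V' : NCSState n m → ℝ)
    (hterm : ∀ ξ ∈ S, ξ.1 ∈ 𝕏 ∧ ξ.2.1 ∈ 𝕌 ∧ 0 ≤ ξ.2.2 ∧ ξ.2.2 ≤ (b : ℤ) ∧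
      ∃ π : NCSInput n m, π.1 ∈ 𝕌 ∧ ncsDyn A B g c b ξ π ∈ S' ∧
        stageCost Q R ξ π + V' (ncsDyn A B g c b ξ π) ≤ V ξ)
    (ξ0 : NCSState n m) (πs : ℕ → NCSInput n m)
    (hf : FeasOCP A B g c b 𝕏 𝕌 ξ0 N S πs) :
    ∃ πs' : ℕ → NCSInput n m,
      FeasOCP A B g c b 𝕏 𝕌 (ncsDyn A B g c b ξ0 (πs 0)) N S' πs' ∧
      costGen A B g c b Q R V' (ncsDyn A B g c b ξ0 (πs 0)) N πs' +
        stageCost Q R ξ0 (πs 0) ≤ costGen A B g c b Q R V ξ0 N πs := by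
  obtain ⟨hst, hend⟩ := hf
  obtain ⟨hx, hu, hb0, hb1, πt, hπt, hdyn, hcost⟩ := hterm _ hend
  let πe : ℕ → NCSInput n m := fun i => if i < N then πs i else πt
  have hπe : ∀ i < N, πe i = πs i := fun i hi => if_pos hi
  have hπeN : πe N = πt := if_neg (lt_irrefl N)
  have htr := ncsTraj_congr A B g c b ξ0 πe πs N hπe
  have h0 : πs 0 = πe 0 := (hπe 0 (by omega)).symm
  have hlast : ncsTraj A B g c b ξ0 πe (N + 1)
      = ncsDyn A B g c b (ncsTraj A B g c b ξ0 πs N) πt := by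
    rw [ncsTraj, htr N le_rfl, hπeN]
  refine ⟨fun i => πe (i + 1), ⟨?_, ?_⟩, ?_⟩
  · intro i hi
    rw [h0, ncsTraj_shift, htr (i + 1) hi]
    simp only
    rcases Nat.lt_or_ge (i + 1) N with h | h
    · rw [hπe _ h]; exact hst _ h
    · obtain rfl : i + 1 = N := by omega
      rw [hπeN]
      exact ⟨hx, hu, hb0, hb1, hπt⟩
  · rw [h0, ncsTraj_shift, hlast]
    exact hdyn
  · unfold costGen
    rw [h0]
    simp only [ncsTraj_shift]
    rw [hlast]
    have e1 := Finset.sum_range_succ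
      (fun i => stageCost Q R (ncsTraj A B g c b ξ0 πe i) (πe i)) N
    rw [Finset.sum_range_succ'] at e1
    have e2 : ∑ i ∈ Finset.range N, stageCost Q R (ncsTraj A B g c b ξ0 πe i) (πe i)
        = ∑ i ∈ Finset.range N, stageCost Q R (ncsTraj A B g c b ξ0 πs i) (πs i) := by
      refine Finset.sum_congr rfl fun i hi => ?_
      have hi := Finset.mem_range.mp hi
      rw [htr i hi.le, hπe i hi]
    rw [e2, hπeN, htr N le_rfl] at e1
    have e3 : ncsTraj A B g c b ξ0 πe 0 = ξ0 := rfl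
    rw [e3] at e1
    linarith

/-- **Theorem 1, Variant 2.** Recursive feasibility,
constraint satisfaction and convergence of rollout ETC with constant
prediction horizon `N̄` and periodically time-varying terminal ingredients
`Ξ_f(k) = S_{k mod M}`, `V_f(ξ, k) = [x; u]ᵀ P_{k mod M} [x; u]`. -/
theorem rolloutETC_variant2_convergence {n m : ℕ}
    (A : Matrix (Fin n) (Fin n) ℝ) (B : Matrix (Fin n) (Fin m) ℝ)
    (K : Matrix (Fin m) (Fin n ⊕ Fin m) ℝ)
    (g c b M : ℕ) (hg : 1 ≤ g) (hgc : g ≤ c) (hcb : c ≤ b)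
    (hM : M = ⌈(c : ℚ) / (g : ℚ)⌉₊) (hM2 : 2 ≤ M)
    (𝕏 : Set (Fin n → ℝ)) (𝕌 : Set (Fin m → ℝ))
    (hXc : IsClosed 𝕏) (hUc : IsClosed 𝕌)
    (hX0 : (0 : Fin n → ℝ) ∈ 𝕏) (hU0 : (0 : Fin m → ℝ) ∈ 𝕌)
    -- Variant-2 terminal set conditions
    (Z : ℕ → Set (Fin n ⊕ Fin m → ℝ))
    (hZc : ∀ j : ℕ, j + 1 ≤ M → IsClosed (Z j))
    (hZ0 : ∀ j : ℕ, j + 1 ≤ M → (0 : Fin n ⊕ Fin m → ℝ) ∈ Z j)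
    (hZsub : ∀ j : ℕ, j + 1 ≤ M → ∀ z ∈ Z j,
      (fun i => z (Sum.inl i)) ∈ 𝕏 ∧ (fun i => z (Sum.inr i)) ∈ 𝕌)
    (hinv1 : ∀ z ∈ Z 0, (A1mat A B K).mulVec z ∈ Z 1)
    (hinv2 : ∀ j : ℕ, 1 ≤ j → j + 2 ≤ M → ∀ z ∈ Z j,
      (A0mat A B).mulVec z ∈ Z (j + 1))
    (hinv3 : ∀ z ∈ Z (M - 1), (A0mat A B).mulVec z ∈ Z 0)
    (hK : ∀ z ∈ Z 0, K.mulVec z ∈ 𝕌)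
    -- cost matrices and Variant-2 terminal cost conditions
    (Q : Matrix (Fin n) (Fin n) ℝ) (R : Matrix (Fin m) (Fin m) ℝ)
    (hQ : Q.PosDef) (hR : R.PosDef)
    (P : ℕ → Matrix (Fin n ⊕ Fin m) (Fin n ⊕ Fin m) ℝ)
    (hP : ∀ j : ℕ, j + 1 ≤ M → (P j).PosSemidef)
    (hMI0 : (-((A1mat A B K)ᵀ * P 1 * A1mat A B K - P 0
        + fromBlocks Q 0 0 0 + Kᵀ * R * K)).PosSemidef)
    (hMIj : ∀ j : ℕ, 1 ≤ j → j + 1 ≤ M →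
      (-((A0mat A B)ᵀ * P ((j + 1) % M) * A0mat A B - P j
          + fromBlocks Q 0 0 R)).PosSemidef)
    -- constant prediction horizon `Nb ≥ 1`
    (Nb : ℕ) (hNb : 1 ≤ Nb)
    -- closed loop generated by Algorithm 1
    (ξcl : ℕ → NCSState n m) (πcl : ℕ → NCSInput n m)
    (hcl : ∀ k : ℕ, ξcl (k + 1) = ncsDyn A B g c b (ξcl k) (πcl k))
    -- whenever the OCP at time `k` is feasible, `π(k)` is the first element
    -- of a minimizer of the OCP at time `k`
    (hopt : ∀ k : ℕ,
      (∃ πs : ℕ → NCSInput n m,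
        FeasOCP A B g c b 𝕏 𝕌 (ξcl k) Nb (termSet g c b Z (k % M)) πs) →
      ∃ πs : ℕ → NCSInput n m,
        FeasOCP A B g c b 𝕏 𝕌 (ξcl k) Nb (termSet g c b Z (k % M)) πs ∧
        (∀ πs' : ℕ → NCSInput n m,
          FeasOCP A B g c b 𝕏 𝕌 (ξcl k) Nb (termSet g c b Z (k % M)) πs' →
          costGen A B g c b Q R
              (fun ξ => vcat ξ.1 ξ.2.1 ⬝ᵥ (P (k % M)).mulVec (vcat ξ.1 ξ.2.1))
              (ξcl k) Nb πs ≤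
            costGen A B g c b Q R
              (fun ξ => vcat ξ.1 ξ.2.1 ⬝ᵥ (P (k % M)).mulVec (vcat ξ.1 ξ.2.1))
              (ξcl k) Nb πs') ∧
        πcl k = πs 0)
    -- feasibility of the OCP at time `0`
    (hfeas0 : ∃ πs : ℕ → NCSInput n m,
      FeasOCP A B g c b 𝕏 𝕌 (ξcl 0) Nb (termSet g c b Z (0 % M)) πs) :
    -- (i) the OCP is feasible at every time `k`
    (∀ k : ℕ, ∃ πs : ℕ → NCSInput n m,
      FeasOCP A B g c b 𝕏 𝕌 (ξcl k) Nb (termSet g c b Z (k % M)) πs) ∧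
    -- (ii) state and input constraints and the token bucket TS are fulfilled
    (∀ k : ℕ, (ξcl k).1 ∈ 𝕏 ∧ (ξcl k).2.1 ∈ 𝕌 ∧
      0 ≤ (ξcl k).2.2 ∧ (ξcl k).2.2 ≤ (b : ℤ) ∧ (πcl k).1 ∈ 𝕌) ∧
    -- (iii) `(x(k), u(k)) → (0, 0)` as `k → ∞`
    Filter.Tendsto (fun k => ((ξcl k).1, (ξcl k).2.1)) Filter.atTop
      (nhds (0, 0)) := by
  have hM0 : 0 < M := by omega
  have hterm : ∀ k : ℕ, ∀ ξ ∈ termSet (n := n) (m := m) g c b Z (k % M), _ := fun k ξ hξ =>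
    terminal_step A B K g c b M hg hgc hcb hM hM2 𝕏 𝕌 hU0 Z hZsub hinv1 hinv2 hinv3 hK
      Q R P hMI0 hMIj (k % M) (Nat.mod_lt k hM0) ξ hξ
  simp only [Nat.mod_add_mod] at hterm
  have hstep := fun k : ℕ => candidate_step A B g c b 𝕏 𝕌 Q R Nb hNb
    (termSet g c b Z (k % M)) (termSet g c b Z ((k + 1) % M))
    (fun ξ => vcat ξ.1 ξ.2.1 ⬝ᵥ (P (k % M)).mulVec (vcat ξ.1 ξ.2.1))
    (fun ξ => vcat ξ.1 ξ.2.1 ⬝ᵥ (P ((k + 1) % M)).mulVec (vcat ξ.1 ξ.2.1))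
    (hterm k) (ξcl k)
  have hfeas : ∀ k : ℕ, ∃ πs : ℕ → NCSInput n m,
      FeasOCP A B g c b 𝕏 𝕌 (ξcl k) Nb (termSet g c b Z (k % M)) πs := by
    intro k
    induction k with
    | zero => exact hfeas0
    | succ k ih =>
      obtain ⟨πs, hf, -, h0⟩ := hopt k ih
      obtain ⟨πs', hf', -⟩ := hstep k πs hf
      rw [hcl, h0]
      exact ⟨πs', hf'⟩
  choose πo hof hom ho0 using fun k => hopt k (hfeas k)
  have hcon : ∀ k : ℕ, (ξcl k).1 ∈ 𝕏 ∧ (ξcl k).2.1 ∈ 𝕌 ∧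
      0 ≤ (ξcl k).2.2 ∧ (ξcl k).2.2 ≤ (b : ℤ) ∧ (πcl k).1 ∈ 𝕌 := by
    intro k
    rw [ho0 k]
    exact (hof k).1 0 (by omega)
  refine ⟨hfeas, hcon, ?_⟩
  -- nonnegativity
  have hQn : ∀ x : Fin n → ℝ, 0 ≤ x ⬝ᵥ Q.mulVec x := fun x => by
    simpa using hQ.posSemidef.dotProduct_mulVec_nonneg x
  have hRn : ∀ x : Fin m → ℝ, 0 ≤ x ⬝ᵥ R.mulVec x := fun x => by
    simpa using hR.posSemidef.dotProduct_mulVec_nonneg x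
  have hln : ∀ (ξ : NCSState n m) (π : NCSInput n m), 0 ≤ stageCost Q R ξ π := by
    intro ξ π
    unfold stageCost
    have := hQn ξ.1
    split_ifs
    · have := hRn π.1; linarith
    · have := hRn ξ.2.1; linarith
  have hPn : ∀ (k : ℕ) (z : Fin n ⊕ Fin m → ℝ), 0 ≤ z ⬝ᵥ (P (k % M)).mulVec z := by
    intro k z
    simpa using (hP (k % M) (Nat.mod_lt k hM0)).dotProduct_mulVec_nonneg z
  let J : ℕ → ℝ := fun k => costGen A B g c b Q R
    (fun ξ => vcat ξ.1 ξ.2.1 ⬝ᵥ (P (k % M)).mulVec (vcat ξ.1 ξ.2.1)) (ξcl k) Nb (πo k)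
  have hJn : ∀ k, 0 ≤ J k := fun k =>
    add_nonneg (Finset.sum_nonneg fun i _ => hln _ _) (hPn k _)
  have hJd : ∀ k, J (k + 1) + stageCost Q R (ξcl k) (πcl k) ≤ J k := by
    intro k
    obtain ⟨πs', hf', hc'⟩ := hstep k (πo k) (hof k)
    rw [← ho0 k, ← hcl k] at hf' hc'
    have := hom (k + 1) πs' hf'
    exact (add_le_add_left this _).trans hc'
  have hsum : Summable (fun k => stageCost Q R (ξcl k) (πcl k)) := by
    refine summable_of_sum_range_le (c := J 0) (fun k => hln _ _) fun N => ?_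
    have : ∑ i ∈ Finset.range N, stageCost Q R (ξcl i) (πcl i) + J N ≤ J 0 := by
      induction N with
      | zero => simp
      | succ N ih =>
        rw [Finset.sum_range_succ]
        have := hJd N
        linarith
    have := hJn N
    linarith
  have hlim := hsum.tendsto_atTop_zero
  have hsc : ∀ k, stageCost Q R (ξcl k) (πcl k) = (ξcl k).1 ⬝ᵥ Q.mulVec (ξcl k).1 +
      (ξcl (k + 1)).2.1 ⬝ᵥ R.mulVec (ξcl (k + 1)).2.1 := by
    intro k
    rw [hcl k]
    unfold stageCost ncsDyn
    cases (πcl k).2 <;> simp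
  have hx : Filter.Tendsto (fun k => (ξcl k).1) Filter.atTop (nhds 0) := by
    refine tendsto_zero_of_quad hQ _ (squeeze_zero (fun k => hQn _) (fun k => ?_) hlim)
    have := hRn (ξcl (k + 1)).2.1
    rw [hsc]; linarith
  have hu : Filter.Tendsto (fun k => (ξcl (k + 1)).2.1) Filter.atTop (nhds 0) := by
    refine tendsto_zero_of_quad hR _ (squeeze_zero (fun k => hRn _) (fun k => ?_) hlim)
    have := hQn (ξcl k).1
    rw [hsc]; linarith
  have hu' : Filter.Tendsto (fun k => (ξcl k).2.1) Filter.atTop (nhds 0) :=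
    (Filter.tendsto_add_atTop_iff_nat (f := fun k => (ξcl k).2.1) 1).mp hu
  exact hx.prodMk_nhds hu'
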